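/- Let C ≥ 1, α_1,…,α_C ∈ (0,1] with Σ_c α_c = 1, and nonnegative gains g_{0,c} and g_{c,c'} satisfying Assumption 1. Define F(s) = s · Σ_{c=1}^C α_c (1 − exp(−s/g_{0,c})) / (Σ_{c'=1}^C α_{c'} g_{c',c} exp(−s/g_{0,c'})) for s > 0 (convention exp(−s/0) = 0), and F(0) = 0. Then F is continuous and strictly increasing on [0,∞) and F(s) → ∞ as s → ∞; consequently, for every ε ∈ (0,1) there is a unique s > 0 with F(s) = ln(1/(1−ε)). -/

import Mathlib

open MeasureTheory ProbabilityTheory Filter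

/-- `expNeg s m = exp(−s/m)` with the convention `exp(−s/0) = 0`. -/
noncomputable def expNeg (s m : ℝ) : ℝ := if m = 0 then 0 else Real.exp (-s / m)

theorem continuous_expNeg (m : ℝ) : Continuous fun s => expNeg s m := by
  unfold expNeg
  split_ifs <;> fun_prop

theorem expNeg_nonneg (s m : ℝ) : 0 ≤ expNeg s m := by
  unfold expNeg
  split_ifs <;> positivity

theorem expNeg_pos (s : ℝ) {m : ℝ} (hm : m ≠ 0) : 0 < expNeg s m := by
  rw [expNeg, if_neg hm]
  exact Real.exp_pos _

theorem antitone_expNeg {m : ℝ} (hm : 0 ≤ m) : Antitone fun s => expNeg s m := by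
  intro s t hst
  simp only [expNeg]
  split_ifs
  · exact le_rfl
  · gcongr

theorem expNeg_le_one {s m : ℝ} (hs : 0 ≤ s) (hm : 0 ≤ m) : expNeg s m ≤ 1 := by
  unfold expNeg
  split_ifs
  · exact zero_le_one
  · exact Real.exp_le_one_iff.2 (div_nonpos_of_nonpos_of_nonneg (by linarith) hm)

theorem expNeg_lt_one {s m : ℝ} (hs : 0 < s) (hm : 0 ≤ m) : expNeg s m < 1 := by
  unfold expNeg
  split_ifs with h
  · exact zero_lt_one
  · exact Real.exp_lt_one_iff.2 (div_neg_of_neg_of_pos (by linarith) (hm.lt_of_ne' h))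

/-- If `G` is monotone on `[0, ∞)` and positive on `(0, ∞)`, then `s * G s` is strictly
increasing on `[0, ∞)`. -/
theorem strictMonoOn_id_mul {G : ℝ → ℝ} (hmono : MonotoneOn G (Set.Ici 0))
    (hpos : ∀ s, 0 < s → 0 < G s) : StrictMonoOn (fun s => s * G s) (Set.Ici 0) := by
  intro s hs t ht hst
  have hs' : (0 : ℝ) ≤ s := hs
  calc s * G s ≤ s * G t := mul_le_mul_of_nonneg_left (hmono hs ht hst.le) hs'
    _ < t * G t := mul_lt_mul_of_pos_right hst (hpos t (hs'.trans_lt hst))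

/-- If `G` is monotone on `[0, ∞)` and positive on `(0, ∞)`, then `s * G s` tends to `∞`. -/
theorem tendsto_id_mul_atTop {G : ℝ → ℝ} (hmono : MonotoneOn G (Set.Ici 0))
    (hpos : ∀ s, 0 < s → 0 < G s) : Tendsto (fun s => s * G s) atTop atTop := by
  refine tendsto_atTop_mono' atTop ?_ (tendsto_id.atTop_mul_const (hpos 1 one_pos))
  filter_upwards [eventually_ge_atTop 1] with s hs
  have hs' : (0 : ℝ) ≤ s := zero_le_one.trans hs
  exact mul_le_mul_of_nonneg_left (hmono (Set.mem_Ici.2 zero_le_one) (Set.mem_Ici.2 hs') hs) hs'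

theorem existsUnique_pos_eq {F : ℝ → ℝ} (hcont : ContinuousOn F (Set.Ici 0))
    (hmono : StrictMonoOn F (Set.Ici 0)) (htop : Tendsto F atTop atTop) (hzero : F 0 = 0)
    {y : ℝ} (hy : 0 < y) : ∃! s : ℝ, 0 < s ∧ F s = y := by
  obtain ⟨M, hM, hM0⟩ := ((htop.eventually_ge_atTop y).and (eventually_ge_atTop 0)).exists
  obtain ⟨s, hs, hsy⟩ := intermediate_value_Icc hM0 (hcont.mono Set.Icc_subset_Ici_self)
    (show y ∈ Set.Icc (F 0) (F M) from ⟨hzero.trans_le hy.le, hM⟩)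
  have hs0 : s ≠ 0 := by
    rintro rfl
    exact hy.ne (hzero.symm.trans hsy)
  refine ⟨s, ⟨hs.1.lt_of_ne' hs0, hsy⟩, fun t ht => ?_⟩
  exact hmono.injOn (Set.mem_Ici.2 ht.1.le) (Set.mem_Ici.2 hs.1) (ht.2.trans hsy.symm)

/-- Under Assumption 1, the function
`F(s) = s Σ_c α_c (1 − e^{−s/g_{0,c}}) / Σ_{c'} α_{c'} g_{c',c} e^{−s/g_{0,c'}}`
(with `F(0) = 0`) is continuous and strictly increasing on `[0,∞)` and tends to `∞`;
hence for every `ε ∈ (0,1)` there is a unique `s > 0` with `F(s) = ln(1/(1−ε))`. -/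
theorem stmt14
    {C : ℕ} (hC : 0 < C)
    (α g0 : Fin C → ℝ) (g : Fin C → Fin C → ℝ)
    (hα : ∀ c, 0 < α c ∧ α c ≤ 1) (hαsum : ∑ c, α c = 1)
    (hg0 : ∀ c, 0 ≤ g0 c) (hg : ∀ c c', 0 ≤ g c c')
    (hconn : ∀ c, ∃ c', 0 < g0 c' * g c' c)
    (F : ℝ → ℝ)
    (hF : ∀ s : ℝ, F s = s * ∑ c, α c * (1 - expNeg s (g0 c)) /
      (∑ c', α c' * g c' c * expNeg s (g0 c'))) :
    ContinuousOn F (Set.Ici 0)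
    ∧ StrictMonoOn F (Set.Ici 0)
    ∧ Tendsto F atTop atTop
    ∧ ∀ ε : ℝ, 0 < ε → ε < 1 →
        ∃! s : ℝ, 0 < s ∧ F s = Real.log (1 / (1 - ε)) := by
  set D : Fin C → ℝ → ℝ := fun c s => ∑ c', α c' * g c' c * expNeg s (g0 c') with hD
  set G : ℝ → ℝ := fun s => ∑ c, α c * (1 - expNeg s (g0 c)) / D c s with hG
  have hDpos : ∀ c s, 0 < D c s := by
    intro c s
    obtain ⟨c', hc'⟩ := hconn c
    refine Finset.sum_pos' (fun i _ => mul_nonneg (mul_nonneg (hα i).1.le (hg i c))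
      (expNeg_nonneg _ _)) ⟨c', Finset.mem_univ _, ?_⟩
    exact mul_pos (mul_pos (hα c').1 (pos_of_mul_pos_right hc' (hg0 c')))
      (expNeg_pos s (left_ne_zero_of_mul hc'.ne'))
  have hDanti : ∀ c, Antitone (D c) := fun c s t hst =>
    Finset.sum_le_sum fun i _ => mul_le_mul_of_nonneg_left (antitone_expNeg (hg0 i) hst)
      (mul_nonneg (hα i).1.le (hg i c))
  have hGcont : Continuous G := by
    refine continuous_finsetSum _ fun c _ => Continuous.div ?_ ?_ fun s => (hDpos c s).ne'
    · exact continuous_const.mul (continuous_const.sub (continuous_expNeg _))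
    · exact continuous_finsetSum _ fun i _ => continuous_const.mul (continuous_expNeg _)
  have hGmono : MonotoneOn G (Set.Ici 0) := by
    intro s hs t ht hst
    refine Finset.sum_le_sum fun c _ => div_le_div₀ ?_ ?_ (hDpos c t) (hDanti c hst)
    · exact mul_nonneg (hα c).1.le (sub_nonneg.2 (expNeg_le_one ht (hg0 c)))
    · exact mul_le_mul_of_nonneg_left (sub_le_sub_left (antitone_expNeg (hg0 c) hst) _)
        (hα c).1.le
  have hGpos : ∀ s, 0 < s → 0 < G s := fun s hs =>
    Finset.sum_pos (fun c _ => div_pos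
      (mul_pos (hα c).1 (sub_pos.2 (expNeg_lt_one hs (hg0 c)))) (hDpos c s))
      ⟨⟨0, hC⟩, Finset.mem_univ _⟩
  have hFG : F = fun s => s * G s := funext hF
  have hcont : ContinuousOn F (Set.Ici 0) := hFG ▸ (continuous_id.mul hGcont).continuousOn
  have hmono : StrictMonoOn F (Set.Ici 0) := hFG ▸ strictMonoOn_id_mul hGmono hGpos
  have htop : Tendsto F atTop atTop := hFG ▸ tendsto_id_mul_atTop hGmono hGpos
  refine ⟨hcont, hmono, htop, fun ε hε0 hε1 => ?_⟩
  refine existsUnique_pos_eq hcont hmono htop (by rw [hF, zero_mul]) (Real.log_pos ?_)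
  rw [lt_div_iff₀ (by linarith)]
  linarith
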